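/- arXiv:1704.02001 — 7 statements merged into one kernel-verified Lean document; each statement's English description precedes it below -/
import Mathlib

section
/- Let J : ℝ × ℝ → ℝ be infinitely differentiable and R : ℝ → ℝ be infinitely differentiable with J(R(ψ), ψ) = 0 for all ψ, and suppose ∂J/∂s(R(ψ₀), ψ₀) ≠ 0 at some ψ₀. Then for every integer k ≥ 1 the following are equivalent: (i) the derivatives R⁽ʲ⁾(ψ₀) vanish for all 1 ≤ j ≤ k; (ii) the partial derivatives ∂ʲJ/∂ψʲ(R(ψ₀), ψ₀) vanish for all 1 ≤ j ≤ k. -/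
open Asymptotics Filter Topology in
/-- A `C^k` function is `o((x - x₀) ^ k)` at `x₀` iff its derivatives up to order `k` vanish
there. -/
theorem iteratedDeriv_eq_zero_iff_isLittleO_pow {f : ℝ → ℝ} {k : ℕ} (hf : ContDiff ℝ k f)
    (x₀ : ℝ) :
    (∀ j ≤ k, iteratedDeriv j f x₀ = 0) ↔ f =o[𝓝 x₀] fun x => (x - x₀) ^ k := by
  constructor
  · intro h
    have ht := taylor_isLittleO_univ (x₀ := x₀) hf
    have hz : ∀ x, taylorWithinEval f k Set.univ x₀ x = 0 := fun x => by
      rw [taylor_within_apply]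
      refine Finset.sum_eq_zero fun j hj => ?_
      rw [iteratedDerivWithin_univ, h j (Nat.lt_succ_iff.mp (Finset.mem_range.mp hj)), smul_zero]
    simpa [hz] using ht
  · intro h j
    induction j using Nat.strong_induction_on with
    | _ j ih =>
      intro hj
      have hpow : (fun x => (x - x₀) ^ k) =O[𝓝 x₀] fun x => (x - x₀) ^ j := by
        have hb : (fun x => (x - x₀) ^ (k - j)) =O[𝓝 x₀] fun _ => (1 : ℝ) :=
          (Continuous.tendsto (by fun_prop) x₀).isBigO_one ℝ
        have := (isBigO_refl (fun x => (x - x₀) ^ j) (𝓝 x₀)).mul hb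
        simpa [← pow_add, Nat.add_sub_cancel' hj] using this
      have ht := taylor_isLittleO_univ (x₀ := x₀) (hf.of_le (Nat.cast_le.mpr hj))
      have hz : ∀ x, taylorWithinEval f j Set.univ x₀ x =
          ((j.factorial : ℝ)⁻¹ * iteratedDeriv j f x₀) * (x - x₀) ^ j := fun x => by
        rw [taylor_within_apply, Finset.sum_range_succ, Finset.sum_eq_zero,
          iteratedDerivWithin_univ, smul_eq_mul]
        · ring
        · intro i hi
          have hi := Finset.mem_range.mp hi
          rw [iteratedDerivWithin_univ, ih i hi (hi.le.trans hj), smul_zero]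
      have hc := (h.trans_isBigO hpow).sub ht
      simp only [hz, sub_sub_cancel] at hc
      by_contra hne
      have hself := (isLittleO_const_mul_left_iff (by positivity)).mp hc
      refine (hself.mono (nhdsWithin_le_nhds (s := {x₀}ᶜ))).not_isBigO ?_ (isBigO_refl _ _)
      refine Eventually.frequently ?_
      filter_upwards [self_mem_nhdsWithin] with x hx
      exact pow_ne_zero _ (sub_ne_zero.mpr hx)

open Asymptotics Filter Topology in
/-- If `J` vanishes along the graph of `R`, then at a simple zero `R - R x₀` and
`J (R x₀, ·)` have the same order of magnitude. -/
theorem isTheta_sub_of_hasStrictFDerivAt {J : ℝ × ℝ → ℝ} {R : ℝ → ℝ} {x₀ : ℝ}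
    {L : ℝ × ℝ →L[ℝ] ℝ} (hJ : HasStrictFDerivAt J L (R x₀, x₀)) (hR : ContinuousAt R x₀)
    (hzero : ∀ x, J (R x, x) = 0) (hL : L (1, 0) ≠ 0) :
    (fun x => J (R x₀, x)) =Θ[𝓝 x₀] fun x => R x - R x₀ := by
  have ht : Tendsto (fun x => ((R x₀, x), (R x, x))) (𝓝 x₀)
      (𝓝 ((R x₀, x₀), (R x₀, x₀))) :=
    (tendsto_const_nhds.prodMk_nhds tendsto_id).prodMk_nhds (hR.tendsto.prodMk_nhds tendsto_id)
  have ho := hJ.isLittleO.comp_tendsto ht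
  have hlin : ∀ r : ℝ, L (r, 0) = r * L (1, 0) := fun r => by
    have := L.map_smul r (1, 0)
    simpa using this
  have ho' : (fun x => J (R x₀, x) - L (1, 0) * (R x₀ - R x)) =o[𝓝 x₀]
      fun x => R x - R x₀ := by
    refine (ho.congr_left fun x => ?_).trans_isBigO (IsBigO.of_bound 1 ?_)
    · simp [hzero, hlin (R x₀ - R x), mul_comm, -map_sub]
    · exact Eventually.of_forall fun x => by simp [Prod.norm_def, abs_sub_comm]
  have hlinTheta : (fun x => L (1, 0) * (R x₀ - R x)) =Θ[𝓝 x₀] fun x => R x - R x₀ := by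
    refine (isTheta_const_mul_left hL).mpr (IsTheta.of_norm_eventuallyEq_norm ?_)
    exact Eventually.of_forall fun x => norm_sub_rev _ _
  have he : IsEquivalent (𝓝 x₀) (fun x => J (R x₀, x)) fun x => L (1, 0) * (R x₀ - R x) :=
    ho'.trans_isTheta hlinTheta.symm
  exact he.isTheta.trans hlinTheta


/-- `R` has an `A_k` singularity at `ψ₀` (first `k` derivatives vanish) iff
the first `k` partial `ψ`-derivatives of `J` vanish at the conjugate point `(R ψ₀, ψ₀)`. -/
theorem conjugate_locus_Ak_iff
    (J : ℝ × ℝ → ℝ) (R : ℝ → ℝ)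
    (hJ : ContDiff ℝ (⊤ : ℕ∞) J) (hR : ContDiff ℝ (⊤ : ℕ∞) R)
    (hzero : ∀ ψ, J (R ψ, ψ) = 0)
    (ψ₀ : ℝ)
    (hs : deriv (fun s => J (s, ψ₀)) (R ψ₀) ≠ 0)
    (k : ℕ) (hk : 1 ≤ k) :
    (∀ j, 1 ≤ j → j ≤ k → iteratedDeriv j R ψ₀ = 0) ↔
      (∀ j, 1 ≤ j → j ≤ k → iteratedDeriv j (fun ψ => J (R ψ₀, ψ)) ψ₀ = 0) := by
  have hJd : HasStrictFDerivAt J (fderiv ℝ J (R ψ₀, ψ₀)) (R ψ₀, ψ₀) :=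
    hJ.contDiffAt.hasStrictFDerivAt (by simp)
  have hL : fderiv ℝ J (R ψ₀, ψ₀) (1, 0) ≠ 0 := by
    have hd := hJd.hasFDerivAt.comp_hasDerivAt (R ψ₀)
      ((hasDerivAt_id (R ψ₀)).prodMk (hasDerivAt_const (R ψ₀) ψ₀))
    exact hd.deriv ▸ hs
  have hTheta := isTheta_sub_of_hasStrictFDerivAt hJd hR.continuous.continuousAt hzero hL
  have hshift : ∀ j, 1 ≤ j →
      iteratedDeriv j (fun ψ => R ψ - R ψ₀) ψ₀ = iteratedDeriv j R ψ₀ := fun j hj => by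
    simp only [sub_eq_neg_add]
    rw [iteratedDeriv_const_add hj]
  have hdrop : ∀ f : ℝ → ℝ, f ψ₀ = 0 →
      ((∀ j, 1 ≤ j → j ≤ k → iteratedDeriv j f ψ₀ = 0) ↔
        ∀ j ≤ k, iteratedDeriv j f ψ₀ = 0) := fun f hf =>
    ⟨fun h j hj => j.eq_zero_or_pos.elim (fun h0 => by simpa [h0] using hf) (h j · hj),
      fun h j _ => h j⟩
  have hRk : ContDiff ℝ k fun ψ => R ψ - R ψ₀ :=
    (hR.sub contDiff_const).of_le (mod_cast le_top)
  have hJk : ContDiff ℝ k fun ψ => J (R ψ₀, ψ) :=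
    (hJ.comp (contDiff_const.prodMk contDiff_id)).of_le (mod_cast le_top)
  rw [hdrop (fun ψ => J (R ψ₀, ψ)) (hzero ψ₀), iteratedDeriv_eq_zero_iff_isLittleO_pow hJk,
    hTheta.isLittleO_congr_left, ← iteratedDeriv_eq_zero_iff_isLittleO_pow hRk,
    ← hdrop (fun ψ => R ψ - R ψ₀) (sub_self _)]
  exact forall₂_congr fun j hj => by rw [hshift j hj]
end

section
/- Let J : ℝ × ℝ → ℝ be infinitely differentiable and R : ℝ → ℝ be infinitely differentiable with J(R(ψ), ψ) = 0 for all ψ. Fix ψ₀ and an integer k ≥ 1, and suppose R⁽ʲ⁾(ψ₀) = 0 for all 1 ≤ j ≤ k − 1. Then ∂J/∂s(R(ψ₀), ψ₀) · R⁽ᵏ⁾(ψ₀) + ∂ᵏJ/∂ψᵏ(R(ψ₀), ψ₀) = 0. -/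
/-- If the derivatives of `R` of orders `1, …, n` vanish at `x`, only the extreme terms of the Leibniz
expansion of the `(n + 1)`-st derivative of `t ↦ G (R t, t)` survive at `x`. -/
theorem iteratedDeriv_succ_comp_graph {G : ℝ × ℝ → ℝ} {R : ℝ → ℝ}
    (hG : ContDiff ℝ (⊤ : ℕ∞) G) (hR : ContDiff ℝ (⊤ : ℕ∞) R) {x : ℝ} {n : ℕ}
    (hlow : ∀ j, 1 ≤ j → j ≤ n → iteratedDeriv j R x = 0) :
    iteratedDeriv (n + 1) (fun t => G (R t, t)) x =
      fderiv ℝ G (R x, x) (1, 0) * iteratedDeriv (n + 1) R x +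
        iteratedDeriv n (fun t => fderiv ℝ G (R t, t) (0, 1)) x := by
  have hfderiv (v : ℝ × ℝ) : ContDiff ℝ (⊤ : ℕ∞) (fun t => fderiv ℝ G (R t, t) v) :=
    ((hG.fderiv_right (m := (⊤ : ℕ∞)) le_rfl).comp (hR.prodMk contDiff_id)).clm_apply
      contDiff_const
  have hderivR : ContDiff ℝ (⊤ : ℕ∞) (deriv R) :=
    (contDiff_infty_iff_deriv.1 hR).2
  have hderiv : deriv (fun t => G (R t, t)) =
      (fun t => fderiv ℝ G (R t, t) (1, 0)) * deriv R +
        fun t => fderiv ℝ G (R t, t) (0, 1) := by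
    funext t
    have hcurve : HasDerivAt (fun t => (R t, t)) (deriv R t, 1) t :=
      ((hR.differentiable (by simp)) t).hasDerivAt.prodMk (hasDerivAt_id t)
    have h := ((hG.differentiable (by simp)) (R t, t)).hasFDerivAt.comp_hasDerivAt
      (f := fun t => (R t, t)) t hcurve
    have hsplit : ((deriv R t, 1) : ℝ × ℝ) = deriv R t • (1, 0) + (0, 1) := by simp
    rw [hsplit, map_add, map_smul, smul_eq_mul, mul_comm] at h
    exact h.deriv
  have hnat {f : ℝ → ℝ} (hf : ContDiff ℝ (⊤ : ℕ∞) f) : ContDiffAt ℝ n f x :=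
    (hf.of_le (by exact_mod_cast le_top)).contDiffAt
  rw [iteratedDeriv_succ', hderiv,
    iteratedDeriv_add (f := (fun t => fderiv ℝ G (R t, t) (1, 0)) * deriv R)
      ((hnat (hfderiv _)).mul (hnat hderivR)) (hnat (hfderiv _)),
    iteratedDeriv_mul (hnat (hfderiv _)) (hnat hderivR),
    Finset.sum_eq_single_of_mem 0 (by simp)]
  · simp [iteratedDeriv_succ']
  · intro i hi hi0
    rw [Finset.mem_range] at hi
    rw [← iteratedDeriv_succ', hlow _ (by omega) (by omega), mul_zero]

theorem iteratedDeriv_comp_graph {R : ℝ → ℝ} (hR : ContDiff ℝ (⊤ : ℕ∞) R) {x : ℝ} {n : ℕ}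
    (hlow : ∀ j, 1 ≤ j → j ≤ n → iteratedDeriv j R x = 0)
    {G : ℝ × ℝ → ℝ} (hG : ContDiff ℝ (⊤ : ℕ∞) G) :
    iteratedDeriv n (fun t => G (R t, t)) x = iteratedDeriv n (fun t => G (R x, t)) x := by
  induction n generalizing G with
  | zero => simp
  | succ n ih =>
    have hlow' : ∀ j, 1 ≤ j → j ≤ n → iteratedDeriv j R x = 0 :=
      fun j h1 h2 => hlow j h1 (by omega)
    have hconst := iteratedDeriv_succ_comp_graph hG (contDiff_const (c := R x)) (x := x) (n := n)
      (fun j h1 _ => by simp [iteratedDeriv_const]; omega)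
    rw [iteratedDeriv_succ_comp_graph hG hR hlow', hlow (n + 1) (by omega) le_rfl, hconst,
      ih hlow' (G := fun p => fderiv ℝ G p (0, 1))
        ((hG.fderiv_right (m := (⊤ : ℕ∞)) le_rfl).clm_apply contDiff_const)]
    simp [iteratedDeriv_const]


/-- differentiating `J (R ψ, ψ) = 0` a total of `k` times with respect to `ψ`,
when the lower-order derivatives of `R` vanish at `ψ₀`, gives
`∂J/∂s (R ψ₀, ψ₀) · R⁽ᵏ⁾(ψ₀) + ∂ᵏJ/∂ψᵏ (R ψ₀, ψ₀) = 0`. -/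
theorem deriv_exp_key_identity
    (J : ℝ × ℝ → ℝ) (R : ℝ → ℝ)
    (hJ : ContDiff ℝ (⊤ : ℕ∞) J) (hR : ContDiff ℝ (⊤ : ℕ∞) R)
    (hzero : ∀ ψ, J (R ψ, ψ) = 0)
    (ψ₀ : ℝ) (k : ℕ) (hk : 1 ≤ k)
    (hlow : ∀ j, 1 ≤ j → j ≤ k - 1 → iteratedDeriv j R ψ₀ = 0) :
    deriv (fun s => J (s, ψ₀)) (R ψ₀) * iteratedDeriv k R ψ₀ +
      iteratedDeriv k (fun ψ => J (R ψ₀, ψ)) ψ₀ = 0 := by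
  obtain ⟨n, rfl⟩ : ∃ n, k = n + 1 := ⟨k - 1, by omega⟩
  rw [Nat.add_sub_cancel] at hlow
  have hs : deriv (fun s => J (s, ψ₀)) (R ψ₀) = fderiv ℝ J (R ψ₀, ψ₀) (1, 0) :=
    (((hJ.differentiable (by simp)) (R ψ₀, ψ₀)).hasFDerivAt.comp_hasDerivAt (R ψ₀)
      ((hasDerivAt_id (R ψ₀)).prodMk (hasDerivAt_const (R ψ₀) ψ₀))).deriv
  have hconst := iteratedDeriv_succ_comp_graph hJ (contDiff_const (c := R ψ₀)) (x := ψ₀) (n := n)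
    (fun j h1 _ => by simp [iteratedDeriv_const]; omega)
  have htotal := iteratedDeriv_succ_comp_graph hJ hR hlow
  rw [iteratedDeriv_comp_graph hR hlow (G := fun p => fderiv ℝ J p (0, 1))
    ((hJ.fderiv_right (m := (⊤ : ℕ∞)) le_rfl).clm_apply contDiff_const)] at htotal
  simp only [hzero, iteratedDeriv_const, Nat.add_eq_zero_iff, one_ne_zero, and_false, if_false,
    mul_zero, zero_add] at hconst htotal
  rw [hs, hconst, ← htotal]
end

section
/- Let k : ℝ → ℝ be differentiable and let ξ₁ : ℝ → ℝ be twice differentiable with ξ₁''(s) = −k(s)·ξ₁(s) for all s. Then the function η₂ := −ξ₁·ξ₁' is twice differentiable and satisfies η₂''(s) = 4·k(s)·ξ₁(s)·ξ₁'(s) + k'(s)·ξ₁(s)² for all s. -/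
/-- `η₂ := -ξ₁·ξ₁'` is twice differentiable and solves the tangential
second-order equation `η₂'' = 4kξ₁ξ₁' + k'ξ₁²` when `ξ₁'' = -kξ₁`. -/
theorem eta2_solves_tangential_equation
    (k ξ₁ : ℝ → ℝ)
    (hk : Differentiable ℝ k)
    (hξ₁ : Differentiable ℝ ξ₁) (hξ₁' : Differentiable ℝ (deriv ξ₁))
    (hjacobi : ∀ s, deriv (deriv ξ₁) s = -(k s * ξ₁ s)) :
    Differentiable ℝ (fun s => -(ξ₁ s * deriv ξ₁ s)) ∧
    Differentiable ℝ (deriv (fun s => -(ξ₁ s * deriv ξ₁ s))) ∧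
    ∀ s, deriv (deriv (fun s => -(ξ₁ s * deriv ξ₁ s))) s =
      4 * k s * ξ₁ s * deriv ξ₁ s + deriv k s * (ξ₁ s) ^ 2 := by
  have first_deriv : ∀ s, HasDerivAt (fun s => -(ξ₁ s * deriv ξ₁ s))
      (k s * ξ₁ s ^ 2 - deriv ξ₁ s ^ 2) s := fun s => by
    have h := ((hξ₁ s).hasDerivAt.mul (hξ₁' s).hasDerivAt).neg
    rw [hjacobi] at h
    exact h.congr_deriv (by ring)
  have second_deriv : ∀ s, HasDerivAt (deriv (fun s => -(ξ₁ s * deriv ξ₁ s)))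
      (4 * k s * ξ₁ s * deriv ξ₁ s + deriv k s * ξ₁ s ^ 2) s := fun s => by
    rw [funext fun t => (first_deriv t).deriv]
    have h := ((hk s).hasDerivAt.mul ((hξ₁ s).hasDerivAt.pow 2)).sub
      ((hξ₁' s).hasDerivAt.pow 2)
    rw [hjacobi] at h
    exact h.congr_deriv (by simp only [Pi.pow_apply]; push_cast; ring)
  exact ⟨fun s => (first_deriv s).differentiableAt,
    fun s => (second_deriv s).differentiableAt, fun s => (second_deriv s).deriv⟩
end

section
/- Let k, g : ℝ → ℝ be differentiable, let ξ₁ : ℝ → ℝ be twice differentiable with ξ₁''(s) = −k(s)·ξ₁(s), and let ξ₂ : ℝ → ℝ be twice differentiable with ξ₂''(s) = −k(s)·ξ₂(s) − g(s)·ξ₁(s)². Then the function η₃ := −ξ₁·ξ₂' − 2·ξ₁'·ξ₂ is twice differentiable and satisfies η₃''(s) = 6·k(s)·(ξ₁·ξ₂)'(s) + 3·k'(s)·ξ₁(s)·ξ₂(s) + 6·g(s)·ξ₁(s)²·ξ₁'(s) + g'(s)·ξ₁(s)³ for all s. -/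
/-- `η₃ := -ξ₁·ξ₂' - 2ξ₁'·ξ₂` is twice differentiable and solves the
tangential third-order equation
`η₃'' = 6k(ξ₁ξ₂)' + 3k'ξ₁ξ₂ + 6gξ₁²ξ₁' + g'ξ₁³`
when `ξ₁'' = -kξ₁` and `ξ₂'' = -kξ₂ - gξ₁²`. -/
theorem eta3_solves_tangential_equation
    (k g ξ₁ ξ₂ : ℝ → ℝ)
    (hk : Differentiable ℝ k) (hg : Differentiable ℝ g)
    (hξ₁ : Differentiable ℝ ξ₁) (hξ₁' : Differentiable ℝ (deriv ξ₁))
    (hξ₂ : Differentiable ℝ ξ₂) (hξ₂' : Differentiable ℝ (deriv ξ₂))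
    (heq₁ : ∀ s, deriv (deriv ξ₁) s = -(k s * ξ₁ s))
    (heq₂ : ∀ s, deriv (deriv ξ₂) s = -(k s * ξ₂ s) - g s * (ξ₁ s) ^ 2) :
    Differentiable ℝ (fun s => -(ξ₁ s * deriv ξ₂ s) - 2 * deriv ξ₁ s * ξ₂ s) ∧
    Differentiable ℝ (deriv (fun s => -(ξ₁ s * deriv ξ₂ s) - 2 * deriv ξ₁ s * ξ₂ s)) ∧
    ∀ s, deriv (deriv (fun s => -(ξ₁ s * deriv ξ₂ s) - 2 * deriv ξ₁ s * ξ₂ s)) s =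
      6 * k s * deriv (fun t => ξ₁ t * ξ₂ t) s + 3 * deriv k s * ξ₁ s * ξ₂ s +
        6 * g s * (ξ₁ s) ^ 2 * deriv ξ₁ s + deriv g s * (ξ₁ s) ^ 3 := by
  have h₁ s : HasDerivAt ξ₁ (deriv ξ₁ s) s := (hξ₁ s).hasDerivAt
  have h₂ s : HasDerivAt ξ₂ (deriv ξ₂ s) s := (hξ₂ s).hasDerivAt
  have h₁' s : HasDerivAt (deriv ξ₁) (-(k s * ξ₁ s)) s := heq₁ s ▸ (hξ₁' s).hasDerivAt
  have h₂' s : HasDerivAt (deriv ξ₂) (-(k s * ξ₂ s) - g s * (ξ₁ s) ^ 2) s :=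
    heq₂ s ▸ (hξ₂' s).hasDerivAt
  have hη' : deriv (fun s => -(ξ₁ s * deriv ξ₂ s) - 2 * deriv ξ₁ s * ξ₂ s) =
      fun s => -3 * (deriv ξ₁ s * deriv ξ₂ s) + 3 * (k s * (ξ₁ s * ξ₂ s)) + g s * ξ₁ s ^ 3 := by
    funext s
    refine HasDerivAt.deriv ((((h₁ s).mul (h₂' s)).neg.sub
      (((h₁' s).const_mul 2).mul (h₂ s))).congr_deriv ?_)
    ring
  refine ⟨by fun_prop, by rw [hη']; fun_prop, fun s => ?_⟩
  have hmul := (h₁ s).mul (h₂ s)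
  rw [hη', show deriv (fun t => ξ₁ t * ξ₂ t) s = _ from hmul.deriv]
  refine HasDerivAt.deriv ((((((h₁' s).mul (h₂' s)).const_mul (-3)).add
    (((hk s).hasDerivAt.mul hmul).const_mul 3)).add
      ((hg s).hasDerivAt.mul ((h₁ s).pow 3))).congr_deriv ?_)
  simp only [Pi.mul_apply, Pi.pow_apply]
  push_cast
  ring
end

section
/- Let α : ℝ → ℝ², R : ℝ → ℝ, T : ℝ → ℝ², N : ℝ → ℝ² and w : ℝ → ℝ all be infinitely differentiable, with ⟨T(ψ), T(ψ)⟩ = 1, ⟨N(ψ), N(ψ)⟩ = 1, ⟨T(ψ), N(ψ)⟩ = 0, α'(ψ) = R'(ψ)·T(ψ) and T'(ψ) = w(ψ)·N(ψ) for all ψ. Fix ψ₀ and an integer k ≥ 0 with R⁽ʲ⁾(ψ₀) = 0 for all 1 ≤ j ≤ k. Then the scalar function h(ψ) := ⟨α(ψ) − α(ψ₀), T(ψ₀)⟩ satisfies h⁽ʲ⁾(ψ₀) = 0 for all 1 ≤ j ≤ k and h⁽ᵏ⁺¹⁾(ψ₀) = R⁽ᵏ⁺¹⁾(ψ₀). 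-/
open scoped RealInnerProductSpace

/-- If all derivatives of `f` of order less than `n` vanish at `x`, then only one term of the
Leibniz formula for the `n`-th derivative of `f * g` at `x` survives. -/
lemma iteratedDeriv_mul_of_forall_lt_eq_zero {𝕜 : Type*} [NontriviallyNormedField 𝕜]
    {f g : 𝕜 → 𝕜} {x : 𝕜} {n : ℕ}
    (hf : ContDiffAt 𝕜 n f x) (hg : ContDiffAt 𝕜 n g x)
    (h : ∀ i < n, iteratedDeriv i f x = 0) :
    iteratedDeriv n (f * g) x = iteratedDeriv n f x * g x := by
  rw [iteratedDeriv_mul hf hg, Finset.sum_range_succ, Finset.sum_eq_zero]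
  · simp
  · intro i hi
    simp [h i (Finset.mem_range.mp hi)]

/-- tangential part of the cusp classification. At an `A_k` singularity
of `R`, the component of the conjugate locus `α` along `T ψ₀` has vanishing derivatives
up to order `k` and `(k+1)`-th derivative equal to `R⁽ᵏ⁺¹⁾(ψ₀)`. -/
theorem conjugate_locus_tangential_component
    (α T N : ℝ → EuclideanSpace ℝ (Fin 2)) (R w : ℝ → ℝ)
    (hα : ContDiff ℝ (⊤ : ℕ∞) α) (hR : ContDiff ℝ (⊤ : ℕ∞) R) (hT : ContDiff ℝ (⊤ : ℕ∞) T)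
    (hN : ContDiff ℝ (⊤ : ℕ∞) N) (hw : ContDiff ℝ (⊤ : ℕ∞) w)
    (hTT : ∀ ψ, ⟪T ψ, T ψ⟫ = 1)
    (hNN : ∀ ψ, ⟪N ψ, N ψ⟫ = 1)
    (hTN : ∀ ψ, ⟪T ψ, N ψ⟫ = 0)
    (hα' : ∀ ψ, deriv α ψ = deriv R ψ • T ψ)
    (hT' : ∀ ψ, deriv T ψ = w ψ • N ψ)
    (ψ₀ : ℝ) (k : ℕ)
    (hRk : ∀ j, 1 ≤ j → j ≤ k → iteratedDeriv j R ψ₀ = 0) :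
    (∀ j, 1 ≤ j → j ≤ k →
        iteratedDeriv j (fun ψ => ⟪α ψ - α ψ₀, T ψ₀⟫) ψ₀ = 0) ∧
    iteratedDeriv (k + 1) (fun ψ => ⟪α ψ - α ψ₀, T ψ₀⟫) ψ₀ =
      iteratedDeriv (k + 1) R ψ₀ := by
  have hderiv : deriv (fun ψ => ⟪α ψ - α ψ₀, T ψ₀⟫) = deriv R * fun ψ => ⟪T ψ, T ψ₀⟫ := by
    funext ψ
    have hd : HasDerivAt (fun ψ => α ψ - α ψ₀) (deriv R ψ • T ψ) ψ := by
      rw [← hα' ψ]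
      exact ((hα.differentiable (by simp)) ψ).hasDerivAt.sub_const _
    have h := hd.inner ℝ (hasDerivAt_const ψ (T ψ₀))
    simpa [inner_smul_left] using h.deriv
  have hR' : ContDiff ℝ (⊤ : ℕ∞) (deriv R) := (contDiff_infty_iff_deriv.mp hR).2
  have hg : ContDiff ℝ (⊤ : ℕ∞) (fun ψ => ⟪T ψ, T ψ₀⟫) := hT.inner ℝ contDiff_const
  have key : ∀ n ≤ k, iteratedDeriv (n + 1) (fun ψ => ⟪α ψ - α ψ₀, T ψ₀⟫) ψ₀ =
      iteratedDeriv (n + 1) R ψ₀ := by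
    intro n hn
    rw [iteratedDeriv_succ', hderiv, iteratedDeriv_mul_of_forall_lt_eq_zero
      (hR'.of_le (by exact_mod_cast le_top)).contDiffAt
      (hg.of_le (by exact_mod_cast le_top)).contDiffAt, hTT, mul_one, ← iteratedDeriv_succ']
    intro i hi
    rw [← iteratedDeriv_succ']
    exact hRk (i + 1) (by omega) (by omega)
  refine ⟨fun j hj hjk => ?_, key k le_rfl⟩
  obtain ⟨n, rfl⟩ := Nat.exists_eq_add_of_le' hj
  rw [key n (by omega), hRk _ hj hjk]
end

section
/- Let α : ℝ → ℝ², R : ℝ → ℝ, T : ℝ → ℝ², N : ℝ → ℝ² and w : ℝ → ℝ all be infinitely differentiable, with ⟨T(ψ), T(ψ)⟩ = 1, ⟨N(ψ), N(ψ)⟩ = 1, ⟨T(ψ), N(ψ)⟩ = 0, α'(ψ) = R'(ψ)·T(ψ) and T'(ψ) = w(ψ)·N(ψ) for all ψ. Fix ψ₀ and an integer k ≥ 0 with R⁽ʲ⁾(ψ₀) = 0 for all 1 ≤ j ≤ k. Then the scalar function f(ψ) := ⟨α(ψ) − α(ψ₀), N(ψ₀)⟩ satisfies f⁽ʲ⁾(ψ₀)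 = 0 for all 1 ≤ j ≤ k + 1 and f⁽ᵏ⁺²⁾(ψ₀) = (k + 1)·R⁽ᵏ⁺¹⁾(ψ₀)·w(ψ₀). -/
open scoped RealInnerProductSpace

/-- Leibniz rule for `g * c` at a zero of `c`, when `g` vanishes there to order `k`. -/
lemma iteratedDeriv_mul_of_vanishing {g c : ℝ → ℝ} {x : ℝ} {k : ℕ}
    (hg : ContDiff ℝ (⊤ : ℕ∞) g) (hc : ContDiff ℝ (⊤ : ℕ∞) c) (hcx : c x = 0)
    (hgk : ∀ j < k, iteratedDeriv j g x = 0) :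
    (∀ n ≤ k, iteratedDeriv n (g * c) x = 0) ∧
      iteratedDeriv (k + 1) (g * c) x = (k + 1 : ℝ) * iteratedDeriv k g x * deriv c x := by
  have leibniz (n : ℕ) := iteratedDeriv_mul (n := n) (x := x)
    (hg.contDiffAt.of_le (by exact_mod_cast le_top)) (hc.contDiffAt.of_le (by exact_mod_cast le_top))
  refine ⟨fun n hn => ?_, ?_⟩
  · rw [leibniz n]
    refine Finset.sum_eq_zero fun i hi => ?_
    rcases lt_or_ge i k with hik | hik
    · simp [hgk i hik]
    · have hni : n - i = 0 := by omega
      simp [hni, hcx]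
  · rw [leibniz (k + 1), Finset.sum_range_succ, Finset.sum_range_succ, Finset.sum_eq_zero]
    · simp [hcx, iteratedDeriv_one]
    · intro i hi
      simp [hgk i (Finset.mem_range.mp hi)]

/-- normal part of the cusp classification. At an `A_k` singularity of `R`,
the component of the conjugate locus `α` along `N ψ₀` has vanishing derivatives up to
order `k + 1` and `(k+2)`-th derivative equal to `(k+1)·R⁽ᵏ⁺¹⁾(ψ₀)·w(ψ₀)`. -/
theorem conjugate_locus_normal_component
    (α T N : ℝ → EuclideanSpace ℝ (Fin 2)) (R w : ℝ → ℝ)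
    (hα : ContDiff ℝ (⊤ : ℕ∞) α) (hR : ContDiff ℝ (⊤ : ℕ∞) R) (hT : ContDiff ℝ (⊤ : ℕ∞) T)
    (hN : ContDiff ℝ (⊤ : ℕ∞) N) (hw : ContDiff ℝ (⊤ : ℕ∞) w)
    (hTT : ∀ ψ, ⟪T ψ, T ψ⟫ = 1)
    (hNN : ∀ ψ, ⟪N ψ, N ψ⟫ = 1)
    (hTN : ∀ ψ, ⟪T ψ, N ψ⟫ = 0)
    (hα' : ∀ ψ, deriv α ψ = deriv R ψ • T ψ)
    (hT' : ∀ ψ, deriv T ψ = w ψ • N ψ)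
    (ψ₀ : ℝ) (k : ℕ)
    (hRk : ∀ j, 1 ≤ j → j ≤ k → iteratedDeriv j R ψ₀ = 0) :
    (∀ j, 1 ≤ j → j ≤ k + 1 →
        iteratedDeriv j (fun ψ => ⟪α ψ - α ψ₀, N ψ₀⟫) ψ₀ = 0) ∧
    iteratedDeriv (k + 2) (fun ψ => ⟪α ψ - α ψ₀, N ψ₀⟫) ψ₀ =
      (k + 1 : ℝ) * iteratedDeriv (k + 1) R ψ₀ * w ψ₀ := by
  have hg : ContDiff ℝ (⊤ : ℕ∞) (deriv R) := (contDiff_infty_iff_deriv.mp hR).2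
  have hc : ContDiff ℝ (⊤ : ℕ∞) (fun ψ => ⟪T ψ, N ψ₀⟫) := hT.inner ℝ contDiff_const
  have hf' : deriv (fun ψ => ⟪α ψ - α ψ₀, N ψ₀⟫) = deriv R * fun ψ => ⟪T ψ, N ψ₀⟫ := by
    funext ψ
    have hα_at : HasDerivAt (fun ψ => α ψ - α ψ₀) (deriv R ψ • T ψ) ψ := by
      rw [← hα']
      exact ((hα.differentiable (by simp)) ψ).hasDerivAt.sub_const _
    simpa [real_inner_smul_left] using (hα_at.inner ℝ (hasDerivAt_const ψ (N ψ₀))).deriv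
  have hc' : deriv (fun ψ => ⟪T ψ, N ψ₀⟫) ψ₀ = w ψ₀ := by
    have hT_at : HasDerivAt T (w ψ₀ • N ψ₀) ψ₀ := by
      rw [← hT']
      exact ((hT.differentiable (by simp)) ψ₀).hasDerivAt
    have h := (hT_at.inner ℝ (hasDerivAt_const ψ₀ (N ψ₀))).deriv
    rw [inner_zero_right, zero_add, real_inner_smul_left, hNN, mul_one] at h
    exact h
  obtain ⟨hlow, htop⟩ := iteratedDeriv_mul_of_vanishing (k := k) hg hc (hTN ψ₀) fun j hj => by
    rw [← iteratedDeriv_succ']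
    exact hRk (j + 1) (by omega) (by omega)
  refine ⟨fun j hj hjk => ?_, ?_⟩
  · obtain ⟨n, rfl⟩ := Nat.exists_eq_add_of_le' hj
    rw [iteratedDeriv_succ', hf']
    exact hlow n (by omega)
  · rw [iteratedDeriv_succ', hf', htop, hc', ← iteratedDeriv_succ']
end

section
/- Let α : ℝ → ℝ², R : ℝ → ℝ, T : ℝ → ℝ², N : ℝ → ℝ² and w : ℝ → ℝ all be infinitely differentiable, with ⟨T(ψ), T(ψ)⟩ = 1, ⟨N(ψ), N(ψ)⟩ = 1, ⟨T(ψ), N(ψ)⟩ = 0, α'(ψ) = R'(ψ)·T(ψ) and T'(ψ) = w(ψ)·N(ψ) for all ψ. Fix ψ₀ and an integer k ≥ 0 with R⁽ʲ⁾(ψ₀) = 0 for all 1 ≤ j ≤ k, R⁽ᵏ⁺¹⁾(ψ₀) ≠ 0 and w(ψ₀) ≠ 0. Then as δ → 0, ⟨α(ψ₀ + δ) − α(ψ₀), T(ψ₀)⟩ = R⁽ᵏ⁺¹⁾(ψ₀)·δ^(k+1)/(k+1)! + o(δ^(k+1)) and ⟨α(ψ₀ + δ) − α(ψ₀), N(ψ₀)⟩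 = (k + 1)·R⁽ᵏ⁺¹⁾(ψ₀)·w(ψ₀)·δ^(k+2)/(k+2)! + o(δ^(k+2)); in particular the leading terms of the expansion of α at ψ₀ in the directions T(ψ₀) and N(ψ₀) are of orders k + 1 and k + 2 respectively, with nonzero coefficients. -/
open scoped RealInnerProductSpace Topology

open Asymptotics in
/-- Monomial leading terms multiply. -/
theorem isLittleO_mul_sub_monomial {f g : ℝ → ℝ} {a b : ℝ} {m n : ℕ}
    (hf : (fun x => f x - a * x ^ m) =o[𝓝 0] fun x => x ^ m)
    (hg : (fun x => g x - b * x ^ n) =o[𝓝 0] fun x => x ^ n) :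
    (fun x => f x * g x - a * b * x ^ (m + n)) =o[𝓝 0] fun x => x ^ (m + n) := by
  have hgO : g =O[𝓝 0] fun x => x ^ n := by
    simpa using hg.isBigO.add ((isBigO_refl (fun x : ℝ => x ^ n) (𝓝 0)).const_mul_left b)
  have hfO : (fun x => a * x ^ m) =O[𝓝 0] fun x : ℝ => x ^ m :=
    (isBigO_refl _ _).const_mul_left a
  refine ((hf.mul_isBigO hgO).add (hfO.mul_isLittleO hg)).congr (fun x => ?_) fun x => ?_ <;> ring

/-- A monomial leading term of the derivative can be integrated. -/
theorem isLittleO_sub_monomial_of_hasDerivAt {f f' : ℝ → ℝ} {a : ℝ} {n : ℕ} (hf₀ : f 0 = 0)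
    (hf : ∀ x, HasDerivAt f (f' x) x)
    (hf' : (fun x => f' x - a * x ^ n) =o[𝓝 0] fun x => x ^ n) :
    (fun x => f x - a / (n + 1) * x ^ (n + 1)) =o[𝓝 0] fun x => x ^ (n + 1) := by
  have hder : ∀ x ∈ Set.univ, HasDerivWithinAt (fun x => f x - a / (n + 1) * x ^ (n + 1))
      (f' x - a * x ^ n) Set.univ x := by
    intro x _
    have hpow : HasDerivAt (fun x : ℝ => a / (n + 1) * x ^ (n + 1)) (a * x ^ n) x := by
      refine ((hasDerivAt_pow (n + 1) x).const_mul (a / (n + 1 : ℝ))).congr_deriv ?_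
      rw [Nat.cast_succ, Nat.add_sub_cancel]
      field_simp
    exact ((hf x).sub hpow).hasDerivWithinAt
  simpa [hf₀] using
    convex_univ.isLittleO_pow_succ_real (Set.mem_univ (0 : ℝ)) hder (by simpa using hf')

/-- Taylor's theorem at a point where the derivatives of order less than `n` vanish. -/
theorem ContDiff.isLittleO_sub_monomial {f : ℝ → ℝ} {x₀ : ℝ} {n : ℕ} (hf : ContDiff ℝ n f)
    (h : ∀ j < n, iteratedDeriv j f x₀ = 0) :
    (fun δ => f (x₀ + δ) - iteratedDeriv n f x₀ / (Nat.factorial n : ℝ) * δ ^ n)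
      =o[𝓝 0] fun δ => δ ^ n := by
  have hlim : Filter.Tendsto (fun δ : ℝ => x₀ + δ) (𝓝 0) (𝓝 x₀) := by
    simpa using (continuous_const_add x₀).tendsto 0
  refine ((taylor_isLittleO_univ (x₀ := x₀) hf).comp_tendsto hlim).congr
    (fun δ => ?_) fun δ => by simp
  have hsum : ∑ j ∈ Finset.range n,
      (((Nat.factorial j : ℝ)⁻¹ * δ ^ j) • iteratedDeriv j f x₀) = 0 :=
    Finset.sum_eq_zero fun j hj => by rw [h j (Finset.mem_range.mp hj), smul_zero]
  simp only [Function.comp_apply, taylor_within_apply, iteratedDerivWithin_univ,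
    Finset.sum_range_succ, add_sub_cancel_left]
  rw [hsum, zero_add, smul_eq_mul]
  ring

/-- If `α' = R' T`, the leading terms of `R'` and of `⟪T, v⟫` determine that of `⟪α, v⟫`. -/
theorem isLittleO_inner_sub_monomial {E : Type*} [NormedAddCommGroup E] [InnerProductSpace ℝ E]
    {α T : ℝ → E} {r : ℝ → ℝ} {v : E} {x₀ a b : ℝ} {m n : ℕ}
    (hα : ∀ x, HasDerivAt α (r x • T x) x)
    (hr : (fun δ => r (x₀ + δ) - a * δ ^ m) =o[𝓝 0] fun δ => δ ^ m)
    (hT : (fun δ => ⟪T (x₀ + δ), v⟫ - b * δ ^ n) =o[𝓝 0] fun δ => δ ^ n) :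
    (fun δ => ⟪α (x₀ + δ) - α x₀, v⟫ - a * b / (m + n + 1) * δ ^ (m + n + 1))
      =o[𝓝 0] fun δ => δ ^ (m + n + 1) := by
  have hder : ∀ δ, HasDerivAt (fun δ => ⟪α (x₀ + δ) - α x₀, v⟫)
      (r (x₀ + δ) * ⟪T (x₀ + δ), v⟫) δ := by
    intro δ
    simpa [real_inner_smul_left] using
      (((hα (x₀ + δ)).comp_const_add x₀ δ).sub_const (α x₀)).inner ℝ (hasDerivAt_const δ v)
  simpa using isLittleO_sub_monomial_of_hasDerivAt (by simp) hder
    (isLittleO_mul_sub_monomial hr hT)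

/-- Proposition 2 of the paper: if `R` has an `A_k` singularity at `ψ₀`
then the conjugate locus is `(k+1, k+2)` at `α ψ₀`: the leading Taylor terms of `α`
at `ψ₀` in the directions `T ψ₀` and `N ψ₀` are
`R⁽ᵏ⁺¹⁾(ψ₀)·δ^(k+1)/(k+1)!` and `(k+1)·R⁽ᵏ⁺¹⁾(ψ₀)·w(ψ₀)·δ^(k+2)/(k+2)!`,
with nonzero coefficients. -/
theorem conjugate_locus_is_kplus1_kplus2
    (α T N : ℝ → EuclideanSpace ℝ (Fin 2)) (R w : ℝ → ℝ)
    (hα : ContDiff ℝ (⊤ : ℕ∞) α) (hR : ContDiff ℝ (⊤ : ℕ∞) R) (hT : ContDiff ℝ (⊤ : ℕ∞) T)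
    (hN : ContDiff ℝ (⊤ : ℕ∞) N) (hw : ContDiff ℝ (⊤ : ℕ∞) w)
    (hTT : ∀ ψ, ⟪T ψ, T ψ⟫ = 1)
    (hNN : ∀ ψ, ⟪N ψ, N ψ⟫ = 1)
    (hTN : ∀ ψ, ⟪T ψ, N ψ⟫ = 0)
    (hα' : ∀ ψ, deriv α ψ = deriv R ψ • T ψ)
    (hT' : ∀ ψ, deriv T ψ = w ψ • N ψ)
    (ψ₀ : ℝ) (k : ℕ)
    (hRk : ∀ j, 1 ≤ j → j ≤ k → iteratedDeriv j R ψ₀ = 0)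
    (hRk1 : iteratedDeriv (k + 1) R ψ₀ ≠ 0)
    (hw₀ : w ψ₀ ≠ 0) :
    (fun δ : ℝ => ⟪α (ψ₀ + δ) - α ψ₀, T ψ₀⟫ -
        iteratedDeriv (k + 1) R ψ₀ * δ ^ (k + 1) / (Nat.factorial (k + 1) : ℝ))
      =o[𝓝 0] (fun δ : ℝ => δ ^ (k + 1)) ∧
    (fun δ : ℝ => ⟪α (ψ₀ + δ) - α ψ₀, N ψ₀⟫ -
        (k + 1 : ℝ) * iteratedDeriv (k + 1) R ψ₀ * w ψ₀ * δ ^ (k + 2) /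
          (Nat.factorial (k + 2) : ℝ))
      =o[𝓝 0] (fun δ : ℝ => δ ^ (k + 2)) ∧
    iteratedDeriv (k + 1) R ψ₀ ≠ 0 ∧
    (k + 1 : ℝ) * iteratedDeriv (k + 1) R ψ₀ * w ψ₀ ≠ 0 := by
  have hαd : ∀ x, HasDerivAt α (deriv R x • T x) x := fun x =>
    hα' x ▸ (hα.differentiable (by simp) x).hasDerivAt
  have hTd : ∀ x, HasDerivAt T (w x • N x) x := fun x =>
    hT' x ▸ (hT.differentiable (by simp) x).hasDerivAt
  have hR' : ContDiff ℝ k (deriv R) := by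
    have hRsucc : ContDiff ℝ (k + 1) R := hR.of_le (by exact_mod_cast le_top)
    exact hRsucc.deriv'
  have hr := hR'.isLittleO_sub_monomial (x₀ := ψ₀) fun j hj => by
    rw [← iteratedDeriv_succ']
    exact hRk (j + 1) (by omega) (by omega)
  rw [← iteratedDeriv_succ'] at hr
  have hTT₀ : (fun δ => ⟪T (ψ₀ + δ), T ψ₀⟫ - 1 * δ ^ 0) =o[𝓝 0] fun δ : ℝ => δ ^ 0 := by
    have hcont : Continuous fun δ => ⟪T (ψ₀ + δ), T ψ₀⟫ - 1 := by
      have := hT.continuous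
      fun_prop
    have hlim := hcont.tendsto 0
    rw [add_zero, hTT, sub_self] at hlim
    simpa [Asymptotics.isLittleO_one_iff] using hlim
  have hTN₀ : (fun δ => ⟪T (ψ₀ + δ), N ψ₀⟫ - w ψ₀ * δ ^ 1) =o[𝓝 0] fun δ : ℝ => δ ^ 1 := by
    have hder : HasDerivAt (fun x => ⟪T x, N ψ₀⟫) (w ψ₀) ψ₀ := by
      simpa only [inner_zero_right, zero_add, real_inner_smul_left, hNN, mul_one] using
        (hTd ψ₀).inner ℝ (hasDerivAt_const ψ₀ (N ψ₀))
    simpa [hTN, mul_comm] using hasDerivAt_iff_isLittleO_nhds_zero.mp hder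
  refine ⟨?_, ?_, hRk1, mul_ne_zero (mul_ne_zero (by positivity) hRk1) hw₀⟩
  · refine (isLittleO_inner_sub_monomial hαd hr hTT₀).congr_left fun δ => ?_
    rw [Nat.factorial_succ]
    push_cast
    simp only [add_zero, mul_one]
    field_simp
  · refine (isLittleO_inner_sub_monomial hαd hr hTN₀).congr_left fun δ => ?_
    rw [Nat.factorial_succ (k + 1), Nat.factorial_succ k]
    push_cast
    field_simp
end
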